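/- arXiv:2208.14550 — 2 statements merged into one kernel-verified Lean document; each statement's English description precedes it below -/
import Mathlib

section
/- There exist c = c(n) and δ̄ = δ̄(n) < 1 such that for all 0 < δ < δ̄ and all r > 0 the following holds. Let C, D ⊂ ℝ^n be open sets and φ: D → C a C¹ diffeomorphism. Suppose x₀ ∈ D satisfies B(x₀, (1+δ)r) ⊆ D and B(φ(x₀), r) ⊆ C, and φ is locally (1+δ)-bilipschitz on B(x₀, (1+δ)r). Then there exists a Euclidean isometry L with L(x₀) = φ(x₀) and sup_{x ∈ B(x₀, r/(1+δ))} |φ(x) − L(x)| ≤ 4cδr. -/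
open Metric

open scoped RealInnerProductSpace

section Bilipschitz

variable {E : Type*} [NormedAddCommGroup E] [InnerProductSpace ℝ E]

theorem norm_apply_le_of_unit_norm_le {F : Type*} [NormedAddCommGroup F] [NormedSpace ℝ F]
    {T : E →L[ℝ] F} {M : ℝ} (h : ∀ v, ‖v‖ = 1 → ‖T v‖ ≤ M) (v : E) : ‖T v‖ ≤ M * ‖v‖ := by
  rcases eq_or_ne v 0 with rfl | hv
  · simp
  have hn : 0 < ‖v‖ := norm_pos_iff.2 hv
  have h1 := h (‖v‖⁻¹ • v) (by rw [norm_smul, norm_inv, norm_norm, inv_mul_cancel₀ hn.ne'])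
  rw [map_smul, norm_smul, norm_inv, norm_norm, inv_mul_le_iff₀ hn] at h1
  linarith

theorem le_norm_apply_of_unit_le_norm {F : Type*} [NormedAddCommGroup F] [NormedSpace ℝ F]
    {T : E →L[ℝ] F} {m : ℝ} (h : ∀ v, ‖v‖ = 1 → m ≤ ‖T v‖) (v : E) : m * ‖v‖ ≤ ‖T v‖ := by
  rcases eq_or_ne v 0 with rfl | hv
  · simp
  have hn : 0 < ‖v‖ := norm_pos_iff.2 hv
  have h1 := h (‖v‖⁻¹ • v) (by rw [norm_smul, norm_inv, norm_norm, inv_mul_cancel₀ hn.ne'])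
  rw [map_smul, norm_smul, norm_inv, norm_norm, le_inv_mul_iff₀ hn] at h1
  linarith

/-- If the derivative of `φ` at `ψ y` expands by at least `K⁻¹` and `ψ` is a right inverse of `φ`
near `y`, then the derivative of `ψ` at `y` is bounded by `K`. -/
theorem norm_fderiv_rightInverse_le {φ ψ : E → E} {C : Set E} (hC : IsOpen C) {K : ℝ} (hK : 0 < K)
    {y : E} (hy : y ∈ C) (hφ : DifferentiableAt ℝ φ (ψ y)) (hψ : DifferentiableAt ℝ ψ y)
    (hinv : ∀ y ∈ C, φ (ψ y) = y) (hlow : ∀ v, ‖v‖ = 1 → K⁻¹ ≤ ‖fderiv ℝ φ (ψ y) v‖) (w : E) :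
    ‖fderiv ℝ ψ y w‖ ≤ K * ‖w‖ := by
  have hcomp : HasFDerivAt (φ ∘ ψ) ((fderiv ℝ φ (ψ y)).comp (fderiv ℝ ψ y)) y :=
    hφ.hasFDerivAt.comp y hψ.hasFDerivAt
  have hid : HasFDerivAt (φ ∘ ψ) (ContinuousLinearMap.id ℝ E) y :=
    (hasFDerivAt_id y).congr_of_eventuallyEq
      (Filter.eventually_of_mem (hC.mem_nhds hy) fun z hz => hinv z hz)
  have heq : fderiv ℝ φ (ψ y) (fderiv ℝ ψ y w) = w :=
    DFunLike.congr_fun (hcomp.unique hid) w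
  have h := le_norm_apply_of_unit_le_norm hlow (fderiv ℝ ψ y w)
  rwa [heq, inv_mul_le_iff₀ hK] at h

/-- If `ψ` has derivative at most `K` wherever it takes values in `ball (ψ y₀) (K * r)`, then it
maps `ball y₀ r` into that ball. -/
theorem mapsTo_ball_of_norm_fderiv_le {ψ : E → E} {y₀ : E} {r K : ℝ} (hK : 0 < K)
    (hψ : ∀ y ∈ ball y₀ r, DifferentiableAt ℝ ψ y)
    (hbound : ∀ y ∈ ball y₀ r, ψ y ∈ ball (ψ y₀) (K * r) → ∀ w, ‖fderiv ℝ ψ y w‖ ≤ K * ‖w‖) :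
    Set.MapsTo ψ (ball y₀ r) (ball (ψ y₀) (K * r)) := by
  intro y hy
  have hw : ‖y - y₀‖ < r := by simpa [dist_eq_norm] using hy
  obtain ⟨M, hM, hMr⟩ := exists_between (mul_lt_mul_of_pos_left hw hK)
  have hM0 : 0 < M := lt_of_le_of_lt (by positivity) hM
  have hmem : ∀ t ∈ Set.Icc (0 : ℝ) 1, y₀ + t • (y - y₀) ∈ ball y₀ r := by
    intro t ht
    have : ‖t • (y - y₀)‖ ≤ ‖y - y₀‖ := by
      rw [norm_smul, Real.norm_of_nonneg ht.1]
      exact mul_le_of_le_one_left (norm_nonneg _) ht.2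
    simpa [dist_eq_norm] using this.trans_lt hw
  have hderiv : ∀ t ∈ Set.Icc (0 : ℝ) 1,
      HasDerivAt (fun t : ℝ => ψ (y₀ + t • (y - y₀)) - ψ y₀)
        (fderiv ℝ ψ (y₀ + t • (y - y₀)) (y - y₀)) t := by
    intro t ht
    have hline : HasDerivAt (fun t : ℝ => y₀ + t • (y - y₀)) (y - y₀) t := by
      simpa using ((hasDerivAt_id t).smul_const (y - y₀)).const_add y₀
    exact ((hψ _ (hmem t ht)).hasFDerivAt.comp_hasDerivAt t hline).sub_const _
  have key := image_norm_le_of_norm_deriv_right_lt_deriv_boundary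
    (f := fun t : ℝ => ψ (y₀ + t • (y - y₀)) - ψ y₀) (a := 0) (b := 1)
    (B := fun t => M * t) (B' := fun _ => M)
    (fun t ht => (hderiv t ht).continuousAt.continuousWithinAt)
    (fun t ht => (hderiv t (Set.Ico_subset_Icc_self ht)).hasDerivWithinAt)
    (by simp) (fun t => by simpa using (hasDerivAt_id t).const_mul M)
    (fun t ht hnorm => by
      refine lt_of_le_of_lt (hbound _ (hmem t (Set.Ico_subset_Icc_self ht)) ?_ _) hM
      rw [mem_ball, dist_eq_norm, hnorm]
      exact lt_of_le_of_lt (mul_le_of_le_one_right hM0.le ht.2.le) hMr)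
    (Set.right_mem_Icc.2 zero_le_one)
  rw [mem_ball, dist_eq_norm]
  refine lt_of_le_of_lt ?_ hMr
  simpa using key

/-- A linear map of a finite-dimensional inner product space carries some orthonormal basis to
multiples of an orthonormal basis, as long as it is injective. -/
theorem exists_orthonormalBasis_map_eq_norm_smul [FiniteDimensional ℝ E] (A : E →ₗ[ℝ] E)
    (hA : Function.Injective A) {n : ℕ} (hn : Module.finrank ℝ E = n) :
    ∃ b b' : OrthonormalBasis (Fin n) ℝ E, ∀ i, A (b i) = ‖A (b i)‖ • b' i := by
  have hT : (LinearMap.adjoint A ∘ₗ A).IsSymmetric := by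
    intro x y
    simp [LinearMap.adjoint_inner_left, LinearMap.adjoint_inner_right]
  let b := hT.eigenvectorBasis hn
  have hpos : ∀ i, 0 < ‖A (b i)‖ := fun i =>
    norm_pos_iff.2 ((map_ne_zero_iff A hA).2 (b.orthonormal.ne_zero i))
  have horth : Orthonormal ℝ fun i => ‖A (b i)‖⁻¹ • A (b i) := by
    refine ⟨fun i => ?_, fun i j hij => ?_⟩
    · rw [norm_smul, norm_inv, norm_norm, inv_mul_cancel₀ (hpos i).ne']
    · have h : ⟪A (b i), A (b j)⟫ = 0 := by
        rw [← LinearMap.adjoint_inner_right]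
        have := hT.apply_eigenvectorBasis hn j
        rw [LinearMap.comp_apply] at this
        rw [this, inner_smul_right, b.orthonormal.2 hij, mul_zero]
      simp [inner_smul_left, inner_smul_right, h]
  have hspan : ⊤ ≤ Submodule.span ℝ (Set.range fun i => ‖A (b i)‖⁻¹ • A (b i)) :=
    (horth.linearIndependent.span_eq_top_of_card_eq_finrank' (by simp [hn])).ge
  refine ⟨b, OrthonormalBasis.mk horth hspan, fun i => ?_⟩
  rw [OrthonormalBasis.coe_mk, smul_inv_smul₀ (hpos i).ne']

theorem abs_inner_sub_inner_le {p : E → E} {R δ : ℝ} (hδ : 0 ≤ δ) (hp0 : p 0 = 0)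
    (hp : ∀ x ∈ ball (0 : E) R, ∀ y ∈ ball (0 : E) R,
      |‖p x - p y‖ ^ 2 - ‖x - y‖ ^ 2| ≤ δ * ‖x - y‖ ^ 2)
    {x y : E} (hx : x ∈ ball 0 R) (hy : y ∈ ball 0 R) :
    |⟪p x, p y⟫ - ⟪x, y⟫| ≤ 3 * δ * R ^ 2 := by
  have hxR : ‖x‖ < R := by simpa using hx
  have hyR : ‖y‖ < R := by simpa using hy
  have h0 : (0 : E) ∈ ball 0 R := mem_ball_self ((norm_nonneg x).trans_lt hxR)
  have h1 := hp x hx 0 h0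
  have h2 := hp y hy 0 h0
  have h3 := hp x hx y hy
  simp only [hp0, sub_zero] at h1 h2
  have hx2 : δ * ‖x‖ ^ 2 ≤ δ * R ^ 2 := by gcongr
  have hy2 : δ * ‖y‖ ^ 2 ≤ δ * R ^ 2 := by gcongr
  have hxy2 : δ * ‖x - y‖ ^ 2 ≤ δ * (R + R) ^ 2 := by
    gcongr
    exact (norm_sub_le x y).trans (by linarith)
  have e1 := norm_sub_sq_real (p x) (p y)
  have e2 := norm_sub_sq_real x y
  rw [abs_le] at *
  constructor <;> nlinarith

theorem abs_sum_mul_le {ι : Type*} [Fintype ι] {u a : ι → ℝ} {U M : ℝ}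
    (hU : 0 ≤ U) (hu : ∀ i, |u i| ≤ U) (ha : ∀ i, |a i| ≤ M) :
    |∑ i, u i * a i| ≤ Fintype.card ι * (U * M) := by
  calc |∑ i, u i * a i| ≤ ∑ i, |u i * a i| := Finset.abs_sum_le_sum_abs _ _
    _ ≤ ∑ _i : ι, U * M := by
        gcongr with i
        rw [abs_mul]
        exact mul_le_mul (hu i) (ha i) (abs_nonneg _) hU
    _ = Fintype.card ι * (U * M) := by simp

theorem abs_inner_orthonormalBasis_le {ι : Type*} [Fintype ι] (e : OrthonormalBasis ι ℝ E)
    (v : E) (i : ι) : |⟪e i, v⟫| ≤ ‖v‖ := by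
  simpa using abs_real_inner_le_norm (e i) v

/-- A map of a ball fixing the center and distorting squared distances by a factor `1 ± δ` is
uniformly close, with an error linear in `δ`, to a linear isometry. -/
theorem exists_linearIsometryEquiv_norm_sub_le [FiniteDimensional ℝ E] {n : ℕ}
    (hn : Module.finrank ℝ E = n) {p : E → E} {R δ : ℝ} (hR : 0 < R) (hδ : 0 ≤ δ)
    (hδn : 12 * n ^ 2 * δ < 1) (hδ1 : δ ≤ 3) (hp0 : p 0 = 0)
    (hp : ∀ x ∈ ball (0 : E) R, ∀ y ∈ ball (0 : E) R,
      |‖p x - p y‖ ^ 2 - ‖x - y‖ ^ 2| ≤ δ * ‖x - y‖ ^ 2) :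
    ∃ O : E ≃ₗᵢ[ℝ] E, ∀ x ∈ ball (0 : E) R,
      ‖p x - O x‖ ≤ n * (24 * n ^ 2 + 6 * n) * δ * R := by
  let e : OrthonormalBasis (Fin n) ℝ E := (stdOrthonormalBasis ℝ E).reindex (finCongr hn)
  have hs : 0 < R / 2 := by positivity
  let q : Fin n → E := fun i => (R / 2)⁻¹ • p ((R / 2) • e i)
  have hmem : ∀ i, (R / 2) • e i ∈ ball (0 : E) R := fun i => by
    simp [norm_smul, abs_of_pos hR]; linarith
  let A : E →ₗ[ℝ] E := e.toBasis.constr ℝ q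
  have hAv : ∀ v, A v = ∑ i, ⟪e i, v⟫ • q i := fun v => by
    simp [A, Module.Basis.constr_apply_fintype, OrthonormalBasis.repr_apply_apply]
  have hexp : ∀ z w v, ⟪z, A v⟫ - ⟪w, v⟫ = ∑ i, ⟪e i, v⟫ * (⟪z, q i⟫ - ⟪w, e i⟫) := by
    intro z w v
    have hwv : ⟪w, v⟫ = ∑ i, ⟪e i, v⟫ * ⟪w, e i⟫ := by
      rw [← e.sum_inner_mul_inner w v]
      simp only [mul_comm]
    simp only [hAv, hwv, inner_sum, inner_smul_right, mul_sub, Finset.sum_sub_distrib]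
  have hpq : ∀ x ∈ ball (0 : E) R, ∀ i, |⟪p x, q i⟫ - ⟪x, e i⟫| ≤ 6 * δ * R := by
    intro x hx i
    have h := abs_inner_sub_inner_le hδ hp0 hp hx (hmem i)
    have : ⟪p x, q i⟫ - ⟪x, e i⟫
        = (R / 2)⁻¹ * (⟪p x, p ((R / 2) • e i)⟫ - ⟪x, (R / 2) • e i⟫) := by
      simp only [q, inner_smul_right]
      field_simp
    rw [this, abs_mul, abs_of_pos (inv_pos.2 hs), inv_mul_le_iff₀ hs]
    linarith
  have hqq : ∀ i j, |⟪q i, q j⟫ - ⟪e i, e j⟫| ≤ 12 * δ := by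
    intro i j
    have h := hpq _ (hmem i) j
    have : ⟪q i, q j⟫ - ⟪e i, e j⟫
        = (R / 2)⁻¹ * (⟪p ((R / 2) • e i), q j⟫ - ⟪(R / 2) • e i, e j⟫) := by
      simp only [q, real_inner_smul_left]
      field_simp
    rw [this, abs_mul, abs_of_pos (inv_pos.2 hs), inv_mul_le_iff₀ hs]
    linarith
  have hpA : ∀ x ∈ ball (0 : E) R, ∀ v, ‖v‖ = 1 → |⟪p x, A v⟫ - ⟪x, v⟫| ≤ 6 * n * δ * R := by
    intro x hx v hv1
    rw [hexp]
    refine (abs_sum_mul_le zero_le_one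
      (fun i => (abs_inner_orthonormalBasis_le e v i).trans hv1.le) (hpq x hx)).trans (le_of_eq ?_)
    simp; ring
  have hAA : ∀ v, ‖v‖ = 1 → |‖A v‖ ^ 2 - 1| ≤ 12 * n ^ 2 * δ := by
    intro v hv1
    have hqA : ∀ i, |⟪q i, A v⟫ - ⟪e i, v⟫| ≤ n * (1 * (12 * δ)) := by
      intro i
      rw [hexp]
      simpa using abs_sum_mul_le zero_le_one
        (fun j => (abs_inner_orthonormalBasis_le e v j).trans hv1.le) (hqq i)
    have : ‖A v‖ ^ 2 - 1 = ∑ i, ⟪e i, v⟫ * (⟪q i, A v⟫ - ⟪e i, v⟫) := by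
      have h1 : ‖A v‖ ^ 2 = ∑ i, ⟪e i, v⟫ * ⟪q i, A v⟫ := by
        rw [← real_inner_self_eq_norm_sq]
        conv_lhs => rw [hAv v, sum_inner]
        simp only [real_inner_smul_left, ← hAv v]
      have h2 : (1 : ℝ) = ∑ i, ⟪e i, v⟫ * ⟪e i, v⟫ := by
        have := e.sum_sq_inner_right v
        simpa [hv1, sq] using this.symm
      rw [h1, h2, ← Finset.sum_sub_distrib]
      simp only [mul_sub]
    rw [this]
    refine (abs_sum_mul_le zero_le_one
      (fun i => (abs_inner_orthonormalBasis_le e v i).trans hv1.le) hqA).trans (le_of_eq ?_)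
    simp; ring
  have hinj : Function.Injective A := by
    rw [injective_iff_map_eq_zero]
    intro v hv0
    by_contra hne
    have hnv : 0 < ‖v‖ := norm_pos_iff.2 hne
    have := hAA (‖v‖⁻¹ • v) (by rw [norm_smul, norm_inv, norm_norm, inv_mul_cancel₀ hnv.ne'])
    simp [hv0] at this
    linarith
  obtain ⟨b, b', hb⟩ := exists_orthonormalBasis_map_eq_norm_smul A hinj hn
  refine ⟨b.equiv b' (Equiv.refl _), fun x hx => ?_⟩
  have hxR : ‖x‖ < R := by simpa using hx
  have hpx : ‖p x‖ ≤ 2 * R := by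
    have h := hp x hx 0 (mem_ball_self hR)
    simp only [hp0, sub_zero] at h
    have hx2 : ‖x‖ ^ 2 ≤ R ^ 2 := by gcongr
    have := (abs_le.1 h).2
    refine abs_le_of_sq_le_sq' ?_ (by positivity) |>.2
    nlinarith [sq_nonneg ‖x‖]
  have hcoord : ∀ i, ‖⟪b' i, p x - b.equiv b' (Equiv.refl _) x⟫‖
      ≤ (24 * n ^ 2 + 6 * n) * δ * R := by
    intro i
    have hOx : ⟪b' i, b.equiv b' (Equiv.refl _) x⟫ = ⟪x, b i⟫ := by
      have : b' i = b.equiv b' (Equiv.refl _) (b i) := by simp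
      rw [this, LinearIsometryEquiv.inner_map_map, real_inner_comm]
    have hA1 : |1 - ‖A (b i)‖| ≤ 12 * n ^ 2 * δ := by
      refine le_trans ?_ (hAA (b i) (b.orthonormal.1 i))
      have : ‖A (b i)‖ ^ 2 - 1 = (‖A (b i)‖ + 1) * (‖A (b i)‖ - 1) := by ring
      rw [this, abs_mul, abs_sub_comm, abs_of_pos (by positivity : 0 < ‖A (b i)‖ + 1)]
      exact le_mul_of_one_le_left (abs_nonneg _) (by linarith [norm_nonneg (A (b i))])
    have hsplit : ⟪b' i, p x - b.equiv b' (Equiv.refl _) x⟫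
        = (1 - ‖A (b i)‖) * ⟪b' i, p x⟫ + (⟪p x, A (b i)⟫ - ⟪x, b i⟫) := by
      have : ⟪p x, A (b i)⟫ = ‖A (b i)‖ * ⟪b' i, p x⟫ := by
        conv_lhs => rw [hb i]
        rw [inner_smul_right, real_inner_comm]
      rw [inner_sub_right, hOx, this]
      ring
    rw [hsplit, Real.norm_eq_abs]
    refine (abs_add_le _ _).trans ?_
    have h1 : |(1 - ‖A (b i)‖) * ⟪b' i, p x⟫| ≤ 12 * n ^ 2 * δ * (2 * R) := by
      rw [abs_mul]
      exact mul_le_mul hA1 ((abs_inner_orthonormalBasis_le b' _ i).trans hpx) (abs_nonneg _)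
        (by positivity)
    have h2 := hpA x hx (b i) (b.orthonormal.1 i)
    linarith
  calc ‖p x - b.equiv b' (Equiv.refl _) x‖
      = ‖∑ i, ⟪b' i, p x - b.equiv b' (Equiv.refl _) x⟫ • b' i‖ := by rw [b'.sum_repr']
    _ ≤ ∑ i, ‖⟪b' i, p x - b.equiv b' (Equiv.refl _) x⟫ • b' i‖ := norm_sum_le _ _
    _ ≤ ∑ _i : Fin n, (24 * n ^ 2 + 6 * n) * δ * R := by
        gcongr with i
        rw [norm_smul, b'.orthonormal.1 i, mul_one]
        exact hcoord i
    _ = n * (24 * n ^ 2 + 6 * n) * δ * R := by simp; ring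

theorem abs_sq_sub_sq_le_of_bilipschitz {a d δ : ℝ} (ha : 0 ≤ a) (hd : 0 ≤ d) (hδ : 0 ≤ δ)
    (hδ1 : δ ≤ 1) (h1 : a ≤ (1 + δ) * d) (h2 : d ≤ (1 + δ) * a) :
    |a ^ 2 - d ^ 2| ≤ 3 * δ * d ^ 2 := by
  have h1' : a ^ 2 ≤ (1 + δ) ^ 2 * d ^ 2 := by rw [← mul_pow]; gcongr
  have h2' : (1 - δ) * d ≤ a := by nlinarith
  have h2'' : (1 - δ) ^ 2 * d ^ 2 ≤ a ^ 2 := by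
    rw [← mul_pow]
    have : 0 ≤ (1 - δ) * d := mul_nonneg (by linarith) hd
    gcongr
  have hd2 : 0 ≤ δ * d ^ 2 := by positivity
  have hd3 : δ ^ 2 * d ^ 2 ≤ δ * d ^ 2 := by
    gcongr
    nlinarith
  rw [abs_le]
  constructor <;> nlinarith

end Bilipschitz

/-- **A locally `(1+δ)`-bilipschitz diffeomorphism of a ball is uniformly
`C⁰`-close to a Euclidean isometry.**
There exist `c = c(n)` and `δ̄ = δ̄(n) < 1` such that for all `0 < δ < δ̄` and
`r > 0`: if `φ : D → C` is a `C¹` diffeomorphism between open subsets of `ℝⁿ`,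
`x₀ ∈ D` with `B(x₀,(1+δ)r) ⊆ D`, `B(φ(x₀),r) ⊆ C`, and `φ` is locally
`(1+δ)`-bilipschitz on `B(x₀,(1+δ)r)`, then there is a Euclidean isometry
`L(x) = O x + v` (with `O` a linear isometry of `ℝⁿ`) such that
`L(x₀) = φ(x₀)` and `‖φ(x) - L(x)‖ ≤ 4 c δ r` on `B(x₀, r/(1+δ))`. -/
theorem bilipschitz_close_to_isometry (n : ℕ) :
    ∃ c : ℝ, 0 < c ∧ ∃ δbar : ℝ, 0 < δbar ∧ δbar < 1 ∧
      ∀ δ r : ℝ, 0 < δ → δ < δbar → 0 < r →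
      ∀ D C : Set (EuclideanSpace ℝ (Fin n)), IsOpen D → IsOpen C →
      ∀ φ ψ : EuclideanSpace ℝ (Fin n) → EuclideanSpace ℝ (Fin n),
        ContDiffOn ℝ 1 φ D → φ '' D = C → ContDiffOn ℝ 1 ψ C →
        (∀ x ∈ D, ψ (φ x) = x) → (∀ y ∈ C, φ (ψ y) = y) →
      ∀ x₀ ∈ D, ball x₀ ((1 + δ) * r) ⊆ D → ball (φ x₀) r ⊆ C →
        (∀ x ∈ ball x₀ ((1 + δ) * r),
          ∀ v : EuclideanSpace ℝ (Fin n), ‖v‖ = 1 →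
            (1 + δ)⁻¹ ≤ ‖fderiv ℝ φ x v‖ ∧ ‖fderiv ℝ φ x v‖ ≤ 1 + δ) →
        ∃ (O : EuclideanSpace ℝ (Fin n) →L[ℝ] EuclideanSpace ℝ (Fin n))
          (v : EuclideanSpace ℝ (Fin n)),
          (∀ z, ‖O z‖ = ‖z‖) ∧
          O x₀ + v = φ x₀ ∧
          ∀ x ∈ ball x₀ (r / (1 + δ)), ‖φ x - (O x + v)‖ ≤ 4 * c * δ * r := by
  refine ⟨n * (24 * n ^ 2 + 6 * n) + 1, by positivity, (36 * n ^ 2 + 2 : ℝ)⁻¹, by positivity,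
    inv_lt_one_of_one_lt₀ (by nlinarith [sq_nonneg (n : ℝ)]), ?_⟩
  intro δ r hδ hδbar hr D C hD hC φ ψ hφ hφDC hψ hψφ hφψ x₀ hx₀ hBD hBC hlip
  have hK : 0 < 1 + δ := by linarith
  have hδn : δ * (36 * n ^ 2 + 2) < 1 := by
    rwa [← one_div, lt_div_iff₀ (by positivity)] at hδbar
  have hδ1 : δ ≤ 1 := by nlinarith [mul_nonneg hδ.le (sq_nonneg (n : ℝ))]
  have hφd : ∀ x ∈ D, DifferentiableAt ℝ φ x := fun x hx =>
    (hφ.differentiableOn one_ne_zero).differentiableAt (hD.mem_nhds hx)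
  have hψd : ∀ y ∈ C, DifferentiableAt ℝ ψ y := fun y hy =>
    (hψ.differentiableOn one_ne_zero).differentiableAt (hC.mem_nhds hy)
  have hψ0 : ψ (φ x₀) = x₀ := hψφ x₀ hx₀
  have hψbound : ∀ y ∈ ball (φ x₀) r, ψ y ∈ ball (ψ (φ x₀)) ((1 + δ) * r) →
      ∀ w, ‖fderiv ℝ ψ y w‖ ≤ (1 + δ) * ‖w‖ := by
    intro y hy hψy
    rw [hψ0] at hψy
    exact norm_fderiv_rightInverse_le hC hK (hBC hy) (hφd _ (hBD hψy)) (hψd y (hBC hy)) hφψ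
      fun v hv => (hlip _ hψy v hv).1
  have hψmaps := mapsTo_ball_of_norm_fderiv_le hK (fun y hy => hψd y (hBC hy)) hψbound
  have hφlip : ∀ x ∈ ball x₀ ((1 + δ) * r), ∀ y ∈ ball x₀ ((1 + δ) * r),
      ‖φ x - φ y‖ ≤ (1 + δ) * ‖x - y‖ := fun x hx y hy =>
    (convex_ball _ _).norm_image_sub_le_of_norm_fderiv_le (fun z hz => hφd z (hBD hz))
      (fun z hz => ContinuousLinearMap.opNorm_le_bound _ hK.le
        (norm_apply_le_of_unit_norm_le fun v hv => (hlip z hz v hv).2)) hy hx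
  have hψlip : ∀ x ∈ ball (φ x₀) r, ∀ y ∈ ball (φ x₀) r,
      ‖ψ x - ψ y‖ ≤ (1 + δ) * ‖x - y‖ := fun x hx y hy =>
    (convex_ball _ _).norm_image_sub_le_of_norm_fderiv_le (fun z hz => hψd z (hBC hz))
      (fun z hz => ContinuousLinearMap.opNorm_le_bound _ hK.le (hψbound z hz (hψmaps hz))) hy hx
  have hRr : r / (1 + δ) ≤ r := div_le_self hr.le (by linarith)
  have hsub : ball x₀ (r / (1 + δ)) ⊆ ball x₀ ((1 + δ) * r) := ball_subset_ball (by nlinarith)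
  have hφmaps : ∀ x ∈ ball x₀ (r / (1 + δ)), φ x ∈ ball (φ x₀) r := by
    intro x hx
    have h := hφlip x (hsub hx) x₀ (mem_ball_self (by positivity))
    rw [mem_ball, dist_eq_norm] at hx ⊢
    rw [lt_div_iff₀ hK] at hx
    linarith
  have hadd : ∀ x ∈ ball (0 : EuclideanSpace ℝ (Fin n)) (r / (1 + δ)),
      x₀ + x ∈ ball x₀ (r / (1 + δ)) := fun x hx => by simpa [dist_eq_norm] using hx
  obtain ⟨O, hO⟩ := exists_linearIsometryEquiv_norm_sub_le (n := n) (by simp)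
    (p := fun x => φ (x₀ + x) - φ x₀) (R := r / (1 + δ)) (δ := 3 * δ) (by positivity)
    (by positivity) (by linarith) (by linarith) (by simp) (fun x hx y hy => by
      have hx' := hadd x hx
      have hy' := hadd y hy
      have h1 := hφlip _ (hsub hx') _ (hsub hy')
      have h2 := hψlip _ (hφmaps _ hx') _ (hφmaps _ hy')
      rw [hψφ _ (hBD (hsub hx')), hψφ _ (hBD (hsub hy'))] at h2
      rw [add_sub_add_left_eq_sub] at h1 h2
      rw [sub_sub_sub_cancel_right]
      exact abs_sq_sub_sq_le_of_bilipschitz (norm_nonneg _) (norm_nonneg _) hδ.le hδ1 h1 h2)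
  refine ⟨(O.toContinuousLinearEquiv : _ →L[ℝ] _), φ x₀ - O x₀, fun z => O.norm_map z,
    by simp, fun x hx => ?_⟩
  have h := hO (x - x₀) (by simpa [dist_eq_norm] using hx)
  have heq : φ x - (O x + (φ x₀ - O x₀)) = φ (x₀ + (x - x₀)) - φ x₀ - O (x - x₀) := by
    rw [add_sub_cancel, map_sub]
    abel
  calc ‖φ x - (O x + (φ x₀ - O x₀))‖
      ≤ n * (24 * n ^ 2 + 6 * n) * (3 * δ) * (r / (1 + δ)) := by rw [heq]; exact h
    _ ≤ n * (24 * n ^ 2 + 6 * n) * (3 * δ) * r := by gcongr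
    _ ≤ 4 * (n * (24 * n ^ 2 + 6 * n) + 1) * δ * r := by
        have h1 : 0 ≤ (n * (24 * n ^ 2 + 6 * n) : ℝ) * (δ * r) := by positivity
        have h2 : 0 < δ * r := by positivity
        linarith
end

section
/- For every b > 0 there exist c = c(n,b) and δ̄ = δ̄(n) < 1 such that for all 0 < δ < δ̄ and all r > 0 the following holds. Let φ: D → C be a smooth diffeomorphism between open sets C, D ⊂ ℝ^n such that the annulus A(0, .5(1−δ)r, (10.5+.5δ)r) ⊆ D, for every x ∈ A(0, r, 10r) the ball B(φ(x), r/4) ⊆ C, and φ is locally (1+δ)-bilipschitz on A(0, .5(1−δ)r, (10.5+.5δ)r). Let ρ: [1,∞) → (0, 1/4] be a C¹ function with |ρ'| ≤ b, and set ρ_r(ℓ) := ρ(ℓ/r) r. Then for every x ∈ A(0, r, 10r), |(d_x φ_{ρ_r})ᵀ (d_x φ_{ρ_r}) − I| ≤ cδ, i.e. ‖(φ_{ρ_r})*δ − δ‖_{C⁰(A(0,r,10r))} ≤ cδ. -/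
open MeasureTheory Metric

/-- The standard mollifier `ζ(z) = c_n exp(-1/(1-|z|²))` for `|z| < 1`, `0`
otherwise, normalized so that `∫ ζ = 1`. -/
noncomputable def stdMollifier (n : ℕ) (z : EuclideanSpace ℝ (Fin n)) : ℝ :=
  (∫ w : EuclideanSpace ℝ (Fin n),
      if ‖w‖ < 1 then Real.exp (-1 / (1 - ‖w‖ ^ 2)) else 0)⁻¹ *
    (if ‖z‖ < 1 then Real.exp (-1 / (1 - ‖z‖ ^ 2)) else 0)

/-- The open Euclidean annulus `A(0,s,t) = {x : s < |x| < t}`. -/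
def annulus (n : ℕ) (s t : ℝ) : Set (EuclideanSpace ℝ (Fin n)) :=
  {x | s < ‖x‖ ∧ ‖x‖ < t}

/-- A right inverse of a map whose derivative expands lengths by at least `K⁻¹` is `K`-Lipschitz on a
ball, provided that the map is controlled on a slightly larger ball in the source. -/
theorem rightInverse_norm_sub_le {E : Type*} [NormedAddCommGroup E] [NormedSpace ℝ E]
    {φ ψ : E → E} {x : E} {K K' R : ℝ} (hK : 0 ≤ K) (hKK' : K < K') (hR : 0 < R)
    (hψ : ∀ y ∈ ball (φ x) R, DifferentiableAt ℝ ψ y)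
    (hφψ : ∀ y ∈ ball (φ x) R, φ (ψ y) = y) (hx : ψ (φ x) = x)
    (hφ : ∀ y ∈ closedBall x (K' * R), DifferentiableAt ℝ φ y)
    (hexp : ∀ y ∈ closedBall x (K' * R), ∀ v, ‖v‖ ≤ K * ‖fderiv ℝ φ y v‖)
    {p q : E} (hp : p ∈ ball (φ x) R) (hq : q ∈ ball (φ x) R) :
    ‖ψ p - ψ q‖ ≤ K * ‖p - q‖ := by
  have hderiv : ∀ y ∈ ball (φ x) R, ψ y ∈ closedBall x (K' * R) → ∀ v,
      ‖fderiv ℝ ψ y v‖ ≤ K * ‖v‖ := by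
    intro y hy hψy v
    have h1 : HasFDerivAt (φ ∘ ψ) ((fderiv ℝ φ (ψ y)).comp (fderiv ℝ ψ y)) y :=
      (hφ _ hψy).hasFDerivAt.comp y (hψ y hy).hasFDerivAt
    have h2 : HasFDerivAt (φ ∘ ψ) (ContinuousLinearMap.id ℝ E) y :=
      (hasFDerivAt_id y).congr_of_eventuallyEq <| by
        filter_upwards [isOpen_ball.mem_nhds hy] with z hz using hφψ z hz
    have h3 := congrArg (fun A : E →L[ℝ] E => A v) (h1.unique h2)
    have h4 := hexp _ hψy (fderiv ℝ ψ y v)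
    simp only [ContinuousLinearMap.comp_apply, ContinuousLinearMap.id_apply] at h3
    rwa [h3] at h4
  have hmaps : ∀ y ∈ ball (φ x) R, ψ y ∈ closedBall x (K' * R) := by
    intro y hy
    set u := y - φ x with hu
    have huR : ‖u‖ < R := by simpa [dist_eq_norm] using hy
    have hmem : ∀ t ∈ Set.Icc (0 : ℝ) 1, φ x + t • u ∈ ball (φ x) R := by
      intro t ht
      rw [mem_ball, dist_eq_norm, add_sub_cancel_left, norm_smul, Real.norm_of_nonneg ht.1]
      nlinarith [ht.2, norm_nonneg u]
    have hd : ∀ t ∈ Set.Icc (0 : ℝ) 1, HasDerivAt (fun t : ℝ => ψ (φ x + t • u) - x)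
        (fderiv ℝ ψ (φ x + t • u) u) t := by
      intro t ht
      have h1 : HasDerivAt (fun t : ℝ => φ x + t • u) u t := by
        simpa using ((hasDerivAt_id t).smul_const u).const_add (φ x)
      exact ((hψ _ (hmem t ht)).hasFDerivAt.comp_hasDerivAt t h1).sub_const x
    have key := image_norm_le_of_norm_deriv_right_lt_deriv_boundary
      (f := fun t : ℝ => ψ (φ x + t • u) - x) (f' := fun t => fderiv ℝ ψ (φ x + t • u) u)
      (a := 0) (b := 1) (B := fun t => K' * R * t) (B' := fun _ => K' * R)
      (fun t ht => (hd t ht).continuousAt.continuousWithinAt)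
      (fun t ht => (hd t ⟨ht.1, ht.2.le⟩).hasDerivWithinAt)
      (by simp [hx])
      (fun t => by simpa using (hasDerivAt_id t).const_mul (K' * R))
      (by
        intro t ht hB
        have hKR : 0 ≤ K' * R := by nlinarith
        have hin : ψ (φ x + t • u) ∈ closedBall x (K' * R) := by
          rw [mem_closedBall, dist_eq_norm, hB]
          nlinarith [ht.2]
        have := hderiv _ (hmem t ⟨ht.1, ht.2.le⟩) hin u
        have h2 : K * ‖u‖ ≤ K * R := by gcongr
        nlinarith)
      (x := 1) (by simp)
    simpa [hu, dist_eq_norm] using key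
  refine (convex_ball (φ x) R).norm_image_sub_le_of_norm_fderiv_le (𝕜 := ℝ) hψ
    (fun y hy => ?_) hq hp
  exact ContinuousLinearMap.opNorm_le_bound _ hK (hderiv y hy (hmaps y hy))

/-- A map that nearly preserves distances in a ball around a fixed point nearly preserves inner
products there. -/
theorem abs_inner_sub_inner_le_of_near_isometry {E : Type*} [NormedAddCommGroup E]
    [InnerProductSpace ℝ E] {g : E → E} {δ σ : ℝ} (hδ : 0 < δ) (hδ1 : δ < 1) (hσ : 0 < σ)
    (hg : g 0 = 0)
    (hup : ∀ v w, ‖v‖ < σ → ‖w‖ < σ → ‖g v - g w‖ ≤ (1 + δ) * ‖v - w‖)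
    (hlow : ∀ v w, ‖v‖ ≤ (1 - δ) * σ → ‖w‖ ≤ (1 - δ) * σ →
      (1 - δ) * ‖v - w‖ ≤ ‖g v - g w‖)
    {v w : E} (hv : ‖v‖ ≤ (1 - δ) * σ) (hw : ‖w‖ ≤ (1 - δ) * σ) :
    |inner ℝ (g v) (g w) - inner ℝ v w| ≤ 9 * δ * σ ^ 2 := by
  have hδσ : (1 - δ) * σ < σ := by nlinarith
  have hsq : ∀ v w, ‖v‖ ≤ (1 - δ) * σ → ‖w‖ ≤ (1 - δ) * σ →
      |‖g v - g w‖ ^ 2 - ‖v - w‖ ^ 2| ≤ 3 * δ * ‖v - w‖ ^ 2 := by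
    intro v w hv hw
    have h1 := hup v w (by linarith) (by linarith)
    have h2 := hlow v w hv hw
    have h3 : ‖g v - g w‖ ^ 2 ≤ ((1 + δ) * ‖v - w‖) ^ 2 := by gcongr
    have h4 : ((1 - δ) * ‖v - w‖) ^ 2 ≤ ‖g v - g w‖ ^ 2 := by
      have : 0 ≤ (1 - δ) * ‖v - w‖ := mul_nonneg (by linarith) (norm_nonneg _)
      gcongr
    have h5 := sq_nonneg ‖v - w‖
    rw [abs_le]
    constructor <;> nlinarith [mul_nonneg hδ.le h5]
  have hz : ‖(0 : E)‖ ≤ (1 - δ) * σ := by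
    rw [norm_zero]; exact mul_nonneg (by linarith) hσ.le
  have h1 := abs_le.1 (hsq v w hv hw)
  have h2 := abs_le.1 (hsq v 0 hv hz)
  have h3 := abs_le.1 (hsq w 0 hw hz)
  simp only [hg, sub_zero] at h2 h3
  have e1 := norm_sub_sq_real (g v) (g w)
  have e2 := norm_sub_sq_real v w
  have hv' : ‖v‖ ≤ σ := by linarith
  have hw' : ‖w‖ ≤ σ := by linarith
  have b1 : ‖v‖ ^ 2 ≤ σ ^ 2 := by gcongr
  have b2 : ‖w‖ ^ 2 ≤ σ ^ 2 := by gcongr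
  have b3 : ‖v - w‖ ^ 2 ≤ (2 * σ) ^ 2 := by
    have := norm_sub_le v w
    gcongr
    linarith
  have c1 := mul_le_mul_of_nonneg_left b1 hδ.le
  have c2 := mul_le_mul_of_nonneg_left b2 hδ.le
  have c3 := mul_le_mul_of_nonneg_left b3 hδ.le
  rw [abs_le]
  constructor <;> nlinarith

/-- A map that nearly preserves distances in a ball is close to a nearly orthogonal linear map,
with an error that is linear in the distortion. -/
theorem exists_linear_approx_of_near_isometry (n : ℕ)
    {g : EuclideanSpace ℝ (Fin n) → EuclideanSpace ℝ (Fin n)} {δ σ : ℝ} (hδ : 0 < δ)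
    (hδn : 72 * ((n : ℝ) + 1) ^ 2 * δ < 1) (hσ : 0 < σ) (hg : g 0 = 0)
    (hup : ∀ v w, ‖v‖ < σ → ‖w‖ < σ → ‖g v - g w‖ ≤ (1 + δ) * ‖v - w‖)
    (hlow : ∀ v w, ‖v‖ ≤ (1 - δ) * σ → ‖w‖ ≤ (1 - δ) * σ →
      (1 - δ) * ‖v - w‖ ≤ ‖g v - g w‖) :
    ∃ L : EuclideanSpace ℝ (Fin n) →L[ℝ] EuclideanSpace ℝ (Fin n), ‖L‖ ≤ 2 ∧
      ‖(ContinuousLinearMap.adjoint L).comp L -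
        ContinuousLinearMap.id ℝ (EuclideanSpace ℝ (Fin n))‖ ≤ 36 * (n : ℝ) ^ 2 * δ ∧
      ∀ v, ‖v‖ < σ → ‖g v - L v‖ ≤ (36 * n + 72 * (n : ℝ) ^ 2 + 4) * δ * σ := by
  have hn0 : (0 : ℝ) ≤ n := n.cast_nonneg
  have hδ1 : δ < 1 / 72 := by nlinarith [mul_nonneg hn0 hδ.le, mul_nonneg (mul_nonneg hn0 hn0) hδ.le]
  have hhalf : 36 * (n : ℝ) ^ 2 * δ ≤ 1 / 2 := by
    nlinarith [mul_nonneg hn0 hδ.le, mul_nonneg (mul_nonneg hn0 hn0) hδ.le]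
  have hδσ : (1 - δ) * σ < σ := by nlinarith
  set e : Fin n → EuclideanSpace ℝ (Fin n) := fun i => EuclideanSpace.single i 1 with he
  have hsum : ∀ v : EuclideanSpace ℝ (Fin n), v = ∑ i, v i • e i := fun v => by
    simpa using ((EuclideanSpace.basisFun (Fin n) ℝ).sum_repr v).symm
  have hcoord : ∀ (v : EuclideanSpace ℝ (Fin n)) i, |v i| ≤ ‖v‖ := fun v i => by
    simpa using PiLp.norm_apply_le v i
  set a : Fin n → EuclideanSpace ℝ (Fin n) := fun i => (σ / 2)⁻¹ • g ((σ / 2) • e i) with ha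
  set L : EuclideanSpace ℝ (Fin n) →L[ℝ] EuclideanSpace ℝ (Fin n) :=
    ∑ i, (EuclideanSpace.proj i : EuclideanSpace ℝ (Fin n) →L[ℝ] ℝ).smulRight (a i) with hL
  have hLapp : ∀ v, L v = ∑ i, v i • a i := fun v => by
    simp [hL]
  have hse : ∀ i, ‖(σ / 2) • e i‖ ≤ (1 - δ) * σ := fun i => by
    rw [norm_smul, Real.norm_of_nonneg (by positivity)]
    simp only [he, PiLp.norm_single, norm_one]
    nlinarith
  have haw : ∀ i w, ‖w‖ ≤ (1 - δ) * σ →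
      |inner ℝ (a i) (g w) - inner ℝ (e i) w| ≤ 18 * δ * σ := by
    intro i w hw
    have h := abs_inner_sub_inner_le_of_near_isometry hδ (by linarith) hσ hg hup hlow (hse i) hw
    rw [inner_smul_left] at h
    have : inner ℝ (a i) (g w) - inner ℝ (e i) w =
        (σ / 2)⁻¹ * (inner ℝ (g ((σ / 2) • e i)) (g w) - (σ / 2) * inner ℝ (e i) w) := by
      simp only [ha, inner_smul_left]
      simp only [conj_trivial]
      field_simp
    rw [this, abs_mul, abs_of_pos (by positivity), inv_mul_le_iff₀ (by positivity)]
    simp only [conj_trivial] at h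
    linarith
  have haa : ∀ i j, |inner ℝ (a i) (a j) - inner ℝ (e i) (e j)| ≤ 36 * δ := by
    intro i j
    have h := haw i _ (hse j)
    have : inner ℝ (a i) (a j) - inner ℝ (e i) (e j) =
        (σ / 2)⁻¹ * (inner ℝ (a i) (g ((σ / 2) • e j)) - inner ℝ (e i) ((σ / 2) • e j)) := by
      conv_lhs => enter [1, 3]; rw [ha]
      simp only [inner_smul_right]
      field_simp
    rw [this, abs_mul, abs_of_pos (by positivity), inv_mul_le_iff₀ (by positivity)]
    linarith
  have hLw : ∀ (M : ℝ) (y w : EuclideanSpace ℝ (Fin n)), 0 ≤ M →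
      (∀ i, |inner ℝ (a i) y - inner ℝ (e i) w| ≤ M) →
      ∀ v, |inner ℝ (L v) y - inner ℝ v w| ≤ n * M * ‖v‖ := by
    intro M y w hM h v
    have : inner ℝ (L v) y - inner ℝ v w =
        ∑ i, v i * (inner ℝ (a i) y - inner ℝ (e i) w) := by
      conv_lhs => rw [hLapp, hsum v]
      simp only [sum_inner, inner_smul_left, conj_trivial, mul_sub, Finset.sum_sub_distrib]
      simp [← hsum v]
    rw [this]
    calc _ ≤ ∑ i, |v i * (inner ℝ (a i) y - inner ℝ (e i) w)| := Finset.abs_sum_le_sum_abs _ _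
      _ ≤ ∑ _i : Fin n, ‖v‖ * M := Finset.sum_le_sum fun i _ => by
          rw [abs_mul]
          exact mul_le_mul (hcoord v i) (h i) (abs_nonneg _) (norm_nonneg _)
      _ = n * M * ‖v‖ := by simp; ring
  have hLg : ∀ v w, ‖w‖ ≤ (1 - δ) * σ →
      |inner ℝ (L v) (g w) - inner ℝ v w| ≤ n * (18 * δ * σ) * ‖v‖ := fun v w hw =>
    hLw _ _ _ (by positivity) (fun i => haw i w hw) v
  have hLL : ∀ v w, |inner ℝ (L v) (L w) - inner ℝ v w| ≤ 36 * (n : ℝ) ^ 2 * δ * ‖v‖ * ‖w‖ := by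
    intro v w
    have := hLw (n * (36 * δ) * ‖w‖) (L w) w (by positivity) (fun i => by
      rw [real_inner_comm, real_inner_comm w]
      refine hLw _ _ _ (by positivity) (fun j => ?_) w
      rw [real_inner_comm, real_inner_comm (e i)]
      exact haa i j) v
    linarith
  have hLnorm : ∀ v, ‖L v‖ ^ 2 ≤ 3 / 2 * ‖v‖ ^ 2 ∧ ‖v‖ ^ 2 ≤ 2 * ‖L v‖ ^ 2 := by
    intro v
    have h := hLL v v
    rw [real_inner_self_eq_norm_sq, real_inner_self_eq_norm_sq, abs_le] at h
    have h2 := mul_le_mul_of_nonneg_right hhalf (sq_nonneg ‖v‖)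
    constructor <;> nlinarith
  have hLop : ∀ v, ‖L v‖ ≤ 2 * ‖v‖ := fun v =>
    (sq_le_sq₀ (norm_nonneg _) (by positivity)).1 (by nlinarith [(hLnorm v).1, sq_nonneg ‖v‖])
  have hsurj : Function.Surjective L := by
    have : Function.Injective (L : EuclideanSpace ℝ (Fin n) →ₗ[ℝ] EuclideanSpace ℝ (Fin n)) := by
      refine (injective_iff_map_eq_zero _).2 fun v hv => ?_
      have h := (hLnorm v).2
      rw [show L v = 0 from hv] at h
      have : ‖v‖ ^ 2 = 0 := le_antisymm (by simpa using h) (sq_nonneg _)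
      simpa using this
    exact LinearMap.injective_iff_surjective.1 this
  have hinside : ∀ w, ‖w‖ ≤ (1 - δ) * σ →
      ‖g w - L w‖ ≤ (36 * n + 72 * (n : ℝ) ^ 2) * δ * σ := by
    intro w hw
    obtain ⟨v, hv⟩ := hsurj (g w - L w)
    have h1 := abs_le.1 (hLg v w hw)
    have h2 := abs_le.1 (hLL v w)
    have h3 := (hLnorm v).2
    have h4 : ‖v‖ ≤ 2 * ‖L v‖ :=
      (sq_le_sq₀ (norm_nonneg _) (by positivity)).1 (by nlinarith [sq_nonneg ‖L v‖])
    have h5 : ‖L v‖ ^ 2 = inner ℝ (L v) (g w) - inner ℝ (L v) (L w) := by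
      rw [← inner_sub_right, ← hv, real_inner_self_eq_norm_sq]
    have h6 : 36 * (n : ℝ) ^ 2 * δ * ‖v‖ * ‖w‖ ≤ 36 * (n : ℝ) ^ 2 * δ * ‖v‖ * σ := by
      gcongr; linarith
    have h7 : ‖L v‖ ^ 2 ≤ (18 * n + 36 * (n : ℝ) ^ 2) * δ * σ * ‖v‖ := by linarith
    have h8 : (18 * n + 36 * (n : ℝ) ^ 2) * δ * σ * ‖v‖ ≤
      (18 * n + 36 * (n : ℝ) ^ 2) * δ * σ * (2 * ‖L v‖) := by gcongr
    rw [← hv]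
    rcases (norm_nonneg (L v)).eq_or_lt with h0 | h0
    · rw [← h0]; positivity
    · nlinarith
  refine ⟨L, L.opNorm_le_bound (by norm_num) hLop,
    ContinuousLinearMap.opNorm_le_bound _ (by positivity) fun v => ?_, fun v hv => ?_⟩
  · set w := ((ContinuousLinearMap.adjoint L).comp L -
        ContinuousLinearMap.id ℝ (EuclideanSpace ℝ (Fin n))) v with hw
    have h1 : ‖w‖ ^ 2 = inner ℝ (L v) (L w) - inner ℝ v w := by
      rw [← real_inner_self_eq_norm_sq]
      nth_rewrite 1 [hw]
      simp [inner_sub_left, ContinuousLinearMap.adjoint_inner_left]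
    have h2 := (abs_le.1 (hLL v w)).2
    rcases (norm_nonneg w).eq_or_lt with h0 | h0
    · rw [← h0]; positivity
    · nlinarith
  · have hw : ‖(1 - δ) • v‖ ≤ (1 - δ) * σ := by
      rw [norm_smul, Real.norm_of_nonneg (by linarith)]
      exact mul_le_mul_of_nonneg_left hv.le (by linarith)
    have h1 := hinside _ hw
    have h2 := hup v ((1 - δ) • v) hv (by linarith)
    have h3 := hLop (v - (1 - δ) • v)
    have h4 : ‖v - (1 - δ) • v‖ = δ * ‖v‖ := by
      rw [show v - (1 - δ) • v = δ • v by module, norm_smul, Real.norm_of_nonneg hδ.le]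
    rw [h4] at h2 h3
    rw [map_sub] at h3
    have h5 : g v - L v = (g v - g ((1 - δ) • v)) + (g ((1 - δ) • v) - L ((1 - δ) • v))
        - (L v - L ((1 - δ) • v)) := by abel
    have h6 : ‖g v - L v‖ ≤ _ := h5 ▸ (norm_sub_le _ _).trans
      (add_le_add_left (norm_add_le _ _) _)
    have h7 : δ * ‖v‖ ≤ δ * σ := by gcongr
    nlinarith [mul_nonneg hδ.le (norm_nonneg v)]

section

open Module (finrank)
open scoped Convolution

variable {E : Type*} [NormedAddCommGroup E] [NormedSpace ℝ E]

/-- The kernel `(s, u) ↦ s⁻ᵈ ζ(u / s)` obtained by rescaling `ζ` to scale `s`, where `d = dim E`. -/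
noncomputable def rescaledKernel (ζ : E → ℝ) (s : ℝ) (u : E) : ℝ :=
  (s ^ finrank ℝ E)⁻¹ * ζ (s⁻¹ • u)

theorem contDiffOn_rescaledKernel {ζ : E → ℝ} (hζ : ContDiff ℝ 1 ζ) :
    ContDiffOn ℝ 1 (↿(rescaledKernel ζ)) (Set.Ioi (0 : ℝ) ×ˢ (Set.univ : Set E)) := by
  have h1 : ContDiffOn ℝ 1 (fun p : ℝ × E => p.1⁻¹) (Set.Ioi (0 : ℝ) ×ˢ Set.univ) :=
    contDiff_fst.contDiffOn.inv fun p hp => (Set.mem_Ioi.1 hp.1).ne'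
  have h2 : ContDiffOn ℝ 1 (fun p : ℝ × E => (p.1 ^ finrank ℝ E)⁻¹)
      (Set.Ioi (0 : ℝ) ×ˢ Set.univ) :=
    (contDiff_fst.pow _).contDiffOn.inv fun p hp => pow_ne_zero _ (Set.mem_Ioi.1 hp.1).ne'
  exact h2.mul (hζ.comp_contDiffOn (h1.smul contDiff_snd.contDiffOn))

theorem rescaledKernel_eq_zero {ζ : E → ℝ} (hζ0 : ∀ z, 1 ≤ ‖z‖ → ζ z = 0) {s : ℝ} (hs : 0 < s)
    {u : E} (hu : s ≤ ‖u‖) : rescaledKernel ζ s u = 0 := by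
  rw [rescaledKernel, hζ0, mul_zero]
  rwa [norm_smul, norm_inv, Real.norm_of_nonneg hs.le, ← div_eq_inv_mul, one_le_div hs]

theorem fderiv_rescaledKernel_eq_zero {ζ : E → ℝ} (hpos : ∀ z, 0 ≤ ζ z)
    (hζ0 : ∀ z, 1 ≤ ‖z‖ → ζ z = 0) {s : ℝ} (hs : 0 < s) {u : E} (hu : s ≤ ‖u‖) :
    fderiv ℝ (↿(rescaledKernel ζ)) (s, u) = 0 := by
  refine IsLocalMin.fderiv_eq_zero ?_
  have : ∀ᶠ p : ℝ × E in nhds (s, u), 0 < p.1 :=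
    continuous_fst.continuousAt.eventually (lt_mem_nhds hs)
  filter_upwards [this] with p hp
  change rescaledKernel ζ s u ≤ rescaledKernel ζ p.1 p.2
  rw [rescaledKernel_eq_zero hζ0 hs hu]
  exact mul_nonneg (by positivity) (hpos _)

theorem fderiv_rescaledKernel_eq_smul (ζ : E → ℝ) {s : ℝ} (hs : 0 < s) (u : E) :
    fderiv ℝ (↿(rescaledKernel ζ)) (s, u) =
      (s ^ (finrank ℝ E + 1))⁻¹ • fderiv ℝ (↿(rescaledKernel ζ)) (1, s⁻¹ • u) := by
  have h1 : (fun p : ℝ × E => (↿(rescaledKernel ζ)) (s⁻¹ • p)) =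
      s ^ finrank ℝ E • (↿(rescaledKernel ζ)) := by
    funext p
    change ((s⁻¹ * p.1) ^ _)⁻¹ * ζ ((s⁻¹ * p.1)⁻¹ • s⁻¹ • p.2) =
      s ^ _ * ((p.1 ^ _)⁻¹ * ζ (p.1⁻¹ • p.2))
    rw [smul_smul, mul_inv, inv_inv, mul_pow, mul_inv, inv_pow, inv_inv, mul_assoc,
      show s * p.1⁻¹ * s⁻¹ = p.1⁻¹ by field_simp]
  have h2 := congrArg (fun f => fderiv ℝ f (s, u)) h1
  simp only [fderiv_comp_smul, fderiv_const_smul_field, Pi.smul_apply] at h2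
  have h3 : s⁻¹ • ((s, u) : ℝ × E) = (1, s⁻¹ • u) := by
    simp [hs.ne']
  rw [h3] at h2
  rw [pow_succ, mul_inv, mul_smul, h2, inv_smul_smul₀ (pow_ne_zero _ hs.ne')]

theorem exists_norm_fderiv_rescaledKernel_le [FiniteDimensional ℝ E] {ζ : E → ℝ}
    (hζ : ContDiff ℝ 1 ζ) (hpos : ∀ z, 0 ≤ ζ z) (hζ0 : ∀ z, 1 ≤ ‖z‖ → ζ z = 0) :
    ∃ K, 0 ≤ K ∧ ∀ s, 0 < s → ∀ u,
      ‖fderiv ℝ (↿(rescaledKernel ζ)) (s, u)‖ ≤ K * (s ^ (finrank ℝ E + 1))⁻¹ := by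
  have hcont : Continuous fun u : E => fderiv ℝ (↿(rescaledKernel ζ)) (1, u) :=
    ((contDiffOn_rescaledKernel hζ).continuousOn_fderiv_of_isOpen
      (isOpen_Ioi.prod isOpen_univ) le_rfl).comp_continuous (by fun_prop) (by simp)
  obtain ⟨K, hK⟩ := (isCompact_closedBall (0 : E) 1).exists_bound_of_continuousOn hcont.continuousOn
  refine ⟨max K 0, le_max_right _ _, fun s hs u => ?_⟩
  rw [fderiv_rescaledKernel_eq_smul ζ hs, norm_smul, mul_comm, Real.norm_of_nonneg (by positivity)]
  gcongr
  by_cases hu : ‖s⁻¹ • u‖ ≤ 1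
  · exact (hK _ (by simpa using hu)).trans (le_max_left _ _)
  · rw [fderiv_rescaledKernel_eq_zero hpos hζ0 one_pos (not_le.1 hu).le, norm_zero]
    exact le_max_right _ _

variable [FiniteDimensional ℝ E] [MeasurableSpace E] [BorelSpace E]

theorem norm_convolution_fderiv_rescaledKernel_le (μ : Measure E) [μ.IsAddHaarMeasure] {ζ : E → ℝ}
    (hpos : ∀ z, 0 ≤ ζ z) (hζ0 : ∀ z, 1 ≤ ‖z‖ → ζ z = 0) {K : ℝ} (hK0 : 0 ≤ K)
    (hK : ∀ s, 0 < s → ∀ u,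
      ‖fderiv ℝ (↿(rescaledKernel ζ)) (s, u)‖ ≤ K * (s ^ (finrank ℝ E + 1))⁻¹)
    {f : E → E} {x : E} {s M : ℝ} (hs : 0 < s) (hf : ∀ y ∈ ball x s, ‖f y‖ ≤ M * s) :
    ‖(f ⋆[(ContinuousLinearMap.lsmul ℝ ℝ : ℝ →L[ℝ] E →L[ℝ] E).flip.precompR (ℝ × E), μ]
      fun u => fderiv ℝ (↿(rescaledKernel ζ)) (s, u)) x‖ ≤ K * μ.real (ball 0 1) * M := by
  have hM : 0 ≤ M * s := (norm_nonneg _).trans (hf x (mem_ball_self hs))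
  rw [convolution_def, ← setIntegral_eq_integral_of_forall_compl_eq_zero (s := ball x s)]
  · have h1 := norm_setIntegral_le_of_norm_le_const (μ := μ) (s := ball x s)
      (f := fun t => (ContinuousLinearMap.precompR (ℝ × E)
        (ContinuousLinearMap.lsmul ℝ ℝ : ℝ →L[ℝ] E →L[ℝ] E).flip) (f t)
        (fderiv ℝ (↿(rescaledKernel ζ)) (s, x - t)))
      (C := M * s * (K * (s ^ (finrank ℝ E + 1))⁻¹)) measure_ball_lt_top (fun t ht => by
        refine ContinuousLinearMap.opNorm_le_bound _ (by positivity) fun v => ?_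
        simp only [ContinuousLinearMap.precompR_apply, ContinuousLinearMap.compL_apply,
          ContinuousLinearMap.comp_apply, ContinuousLinearMap.flip_apply,
          ContinuousLinearMap.lsmul_apply, norm_smul]
        calc _ ≤ (K * (s ^ (finrank ℝ E + 1))⁻¹ * ‖v‖) * (M * s) := by
              gcongr
              · exact ContinuousLinearMap.le_of_opNorm_le _ (hK s hs _) v
              · exact hf t ht
          _ = _ := by ring)
    refine h1.trans (le_of_eq ?_)
    rw [measureReal_def, Measure.addHaar_ball_of_pos μ x hs, ENNReal.toReal_mul,
      ENNReal.toReal_ofReal (by positivity), ← measureReal_def]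
    field_simp
    ring
  · intro t ht
    rw [fderiv_rescaledKernel_eq_zero hpos hζ0 hs, map_zero]
    simpa [dist_eq_norm, norm_sub_rev] using ht

theorem convolution_rescaledKernel (μ : Measure E) [μ.IsAddHaarMeasure] (ζ : E → ℝ) (f : E → E)
    {s : ℝ} (hs : 0 < s) (w : E) :
    (f ⋆[(ContinuousLinearMap.lsmul ℝ ℝ : ℝ →L[ℝ] E →L[ℝ] E).flip, μ] rescaledKernel ζ s) w =
      ∫ z, ζ z • f (w - s • z) ∂μ := by
  rw [convolution_def]
  have h1 : ∀ t, (ContinuousLinearMap.lsmul ℝ ℝ : ℝ →L[ℝ] E →L[ℝ] E).flip (f t)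
      (rescaledKernel ζ s (w - t)) =
      (s ^ finrank ℝ E)⁻¹ • (fun u => ζ (s⁻¹ • u) • f (w - s • s⁻¹ • u)) (w - t) := by
    intro t
    simp [rescaledKernel, smul_smul, hs.ne']
  simp_rw [h1]
  rw [integral_smul, integral_sub_left_eq_self (fun u => ζ (s⁻¹ • u) • f (w - s • s⁻¹ • u)),
    Measure.integral_comp_inv_smul_of_nonneg μ (fun z => ζ z • f (w - s • z)) hs.le,
    inv_smul_smul₀ (pow_ne_zero _ hs.ne')]

theorem integral_even_smul_linear_eq_zero (μ : Measure E) [μ.IsAddHaarMeasure] {ζ : E → ℝ}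
    (heven : ∀ z, ζ (-z) = ζ z) (L : E →L[ℝ] E) : ∫ z, ζ z • L z ∂μ = 0 := by
  have h := integral_neg_eq_self (fun z => ζ z • L z) μ
  simp only [heven, map_neg, smul_neg, integral_neg] at h
  have h2 : (2 : ℝ) • ∫ z, ζ z • L z ∂μ = 0 := by
    rw [two_smul]
    nth_rewrite 1 [← h]
    exact neg_add_cancel _
  exact (smul_eq_zero.1 h2).resolve_left two_ne_zero

theorem integral_smul_affine_comp (μ : Measure E) [μ.IsAddHaarMeasure] {ζ : E → ℝ}
    (hζ : Continuous ζ) (hζ0 : ∀ z, 1 ≤ ‖z‖ → ζ z = 0) (heven : ∀ z, ζ (-z) = ζ z)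
    (hint : ∫ z, ζ z ∂μ = 1) {f φ : E → E} (hf : Integrable f μ) {L : E →L[ℝ] E} {c w x : E} {s : ℝ}
    (hs : 0 < s) (hφ : ∀ z, ‖z‖ < 1 → φ (w - s • z) = f (w - s • z) + c + L (w - s • z - x)) :
    ∫ z, ζ z • φ (w - s • z) ∂μ = ∫ z, ζ z • f (w - s • z) ∂μ + (c + L (w - x)) := by
  have hsupp : HasCompactSupport ζ := HasCompactSupport.intro (isCompact_closedBall 0 1)
    fun z hz => hζ0 z (by simpa using (not_le.1 (fun h => hz (by simpa using h))).le)
  obtain ⟨C, hC⟩ := hsupp.exists_bound_of_continuous hζ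
  have i1 : Integrable (fun z => ζ z • f (w - s • z)) μ :=
    Integrable.bdd_smul ((hf.comp_sub_left w).comp_smul hs.ne') C
      hζ.aestronglyMeasurable (Filter.Eventually.of_forall hC)
  have i2 : Integrable (fun z => ζ z • (c + L (w - x))) μ :=
    (hζ.integrable_of_hasCompactSupport hsupp).smul_const _
  have i3 : Integrable (fun z => ζ z • (s • L) z) μ :=
    (hζ.smul (s • L).continuous).integrable_of_hasCompactSupport hsupp.smul_right
  have i12 : Integrable (fun z => ζ z • f (w - s • z) + ζ z • (c + L (w - x))) μ := i1.add i2
  have h : ∀ z, ζ z • φ (w - s • z) =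
      ζ z • f (w - s • z) + ζ z • (c + L (w - x)) - ζ z • (s • L) z := by
    intro z
    by_cases hz : ‖z‖ < 1
    · rw [hφ z hz, ← smul_add, ← smul_sub]
      congr 1
      simp only [map_sub, map_smul, smul_apply]
      abel
    · simp [hζ0 z (not_lt.1 hz)]
  simp_rw [h]
  rw [integral_sub i12 i3, integral_add i1 i2, integral_smul_const, hint, one_smul,
    integral_even_smul_linear_eq_zero μ heven, sub_zero]

/-- If `φ` is close to an affine map at the scale of the mollification, then the derivative of the
mollification of `φ` with varying scale is close to the linear part of that map. -/
theorem exists_hasFDerivAt_mollification (μ : Measure E) [μ.IsAddHaarMeasure] {ζ : E → ℝ}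
    (hζ : ContDiff ℝ 1 ζ) (hpos : ∀ z, 0 ≤ ζ z) (hζ0 : ∀ z, 1 ≤ ‖z‖ → ζ z = 0)
    (heven : ∀ z, ζ (-z) = ζ z) (hint : ∫ z, ζ z ∂μ = 1) :
    ∃ K, 0 ≤ K ∧ ∀ (φ : E → E) (σ : E → ℝ) (σ' : E →L[ℝ] ℝ) (L : E →L[ℝ] E) (x : E) (R M : ℝ),
      ContinuousOn φ (closedBall x R) → HasFDerivAt σ σ' x → 0 < σ x → σ x < R →
      (∀ y ∈ ball x (σ x), ‖φ y - φ x - L (y - x)‖ ≤ M * σ x) →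
      ∃ A, HasFDerivAt (fun w => ∫ z, ζ z • φ (w - σ w • z) ∂μ) A x ∧
        ‖A - L‖ ≤ K * M * (1 + ‖σ'‖) := by
  obtain ⟨K, hK0, hK⟩ := exists_norm_fderiv_rescaledKernel_le hζ hpos hζ0
  refine ⟨K * μ.real (ball 0 1), by positivity, ?_⟩
  intro φ σ σ' L x R M hφ hσ hσ0 hσR hM
  set f : E → E := (closedBall x R).indicator fun y => φ y - φ x - L (y - x) with hf
  have hfint : Integrable f μ := by
    rw [hf, integrable_indicator_iff isClosed_closedBall.measurableSet]
    exact ContinuousOn.integrableOn_compact (isCompact_closedBall x R) (by fun_prop)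
  have hfM : ∀ y ∈ ball x (σ x), ‖f y‖ ≤ M * σ x := fun y hy => by
    rw [hf, Set.indicator_of_mem (closedBall_subset_closedBall hσR.le (ball_subset_closedBall hy))]
    exact hM y hy
  have hconv := hasFDerivAt_convolution_right_with_param (μ := μ) (𝕜 := ℝ)
    (ContinuousLinearMap.lsmul ℝ ℝ : ℝ →L[ℝ] E →L[ℝ] E).flip (g := rescaledKernel ζ)
    (s := Set.Ioo 0 R) (k := closedBall 0 R) isOpen_Ioo (isCompact_closedBall 0 R)
    (fun s u hs hu => rescaledKernel_eq_zero hζ0 hs.1 (by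
      have : R < ‖u‖ := by simpa using hu
      linarith [hs.2]))
    hfint.locallyIntegrable
    ((contDiffOn_rescaledKernel hζ).mono (Set.prod_mono (fun s hs => hs.1) subset_rfl))
    (σ x, x) ⟨hσ0, hσR⟩
  have hcomp := HasFDerivAt.comp (f := fun w => (σ w, w)) x hconv (hσ.prodMk (hasFDerivAt_id x))
  have hL : HasFDerivAt (fun w => φ x + L (w - x)) L x := by
    simpa using (L.hasFDerivAt.comp x ((hasFDerivAt_id x).sub_const x)).const_add (φ x)
  refine ⟨_, (hcomp.add hL).congr_of_eventuallyEq ?_, ?_⟩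
  · have e1 : ∀ᶠ w in nhds x, 0 < σ w := hσ.continuousAt.eventually (lt_mem_nhds hσ0)
    have e2 : ∀ᶠ w in nhds x, ‖w - x‖ + σ w < R := by
      have : ContinuousAt (fun w => ‖w - x‖ + σ w) x := by
        have := hσ.continuousAt
        fun_prop
      exact this.eventually (gt_mem_nhds (by simpa using hσR))
    filter_upwards [e1, e2] with w h1 h2
    simp only [Pi.add_apply, Function.comp_apply]
    rw [convolution_rescaledKernel μ ζ f h1]
    refine integral_smul_affine_comp μ hζ.continuous hζ0 heven hint hfint h1 fun z hz => ?_
    rw [hf, Set.indicator_of_mem]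
    · abel
    · rw [mem_closedBall, dist_eq_norm, show w - σ w • z - x = (w - x) - σ w • z by abel]
      refine (norm_sub_le _ _).trans ?_
      rw [norm_smul, Real.norm_of_nonneg h1.le]
      nlinarith
  · rw [add_sub_cancel_right]
    refine (ContinuousLinearMap.opNorm_comp_le _ _).trans ?_
    have h1 := norm_convolution_fderiv_rescaledKernel_le μ hpos hζ0 hK0 hK hσ0 hfM
    have h2 : ‖σ'.prod (ContinuousLinearMap.id ℝ E)‖ ≤ 1 + ‖σ'‖ := by
      refine ContinuousLinearMap.opNorm_le_bound _ (by positivity) fun v => ?_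
      rw [ContinuousLinearMap.prod_apply, Prod.norm_mk]
      refine max_le ?_ ?_
      · nlinarith [σ'.le_opNorm v, norm_nonneg v]
      · simpa using le_mul_of_one_le_left (norm_nonneg v) (by linarith [norm_nonneg σ'])
    exact mul_le_mul h1 h2 (norm_nonneg _) ((norm_nonneg _).trans h1)

end

theorem stdMollifier_eq_expNegInvGlue (n : ℕ) (z : EuclideanSpace ℝ (Fin n)) :
    stdMollifier n z = (∫ w : EuclideanSpace ℝ (Fin n), expNegInvGlue (1 - ‖w‖ ^ 2))⁻¹ *
      expNegInvGlue (1 - ‖z‖ ^ 2) := by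
  have h : ∀ w : EuclideanSpace ℝ (Fin n),
      (if ‖w‖ < 1 then Real.exp (-1 / (1 - ‖w‖ ^ 2)) else 0) = expNegInvGlue (1 - ‖w‖ ^ 2) := by
    intro w
    have h1 : 1 - ‖w‖ ^ 2 ≤ 0 ↔ ¬ ‖w‖ < 1 := by
      rw [sub_nonpos, not_lt, one_le_sq_iff₀ (norm_nonneg w)]
    simp only [expNegInvGlue, h1, ite_not, div_eq_mul_inv, neg_one_mul]
  simp only [stdMollifier, h]

theorem contDiff_expNegInvGlue_one_sub_norm_sq (n : ℕ) :
    ContDiff ℝ 1 fun z : EuclideanSpace ℝ (Fin n) => expNegInvGlue (1 - ‖z‖ ^ 2) :=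
  expNegInvGlue.contDiff.comp (contDiff_const.sub (contDiff_norm_sq ℝ))

theorem integral_expNegInvGlue_one_sub_norm_sq_pos (n : ℕ) :
    0 < ∫ w : EuclideanSpace ℝ (Fin n), expNegInvGlue (1 - ‖w‖ ^ 2) := by
  refine (contDiff_expNegInvGlue_one_sub_norm_sq n).continuous
    |>.integral_pos_of_hasCompactSupport_nonneg_nonzero
    (HasCompactSupport.intro (isCompact_closedBall 0 1) fun z hz => ?_)
    (fun z => expNegInvGlue.nonneg _) (x := 0) ?_
  · have : 1 < ‖z‖ := by simpa using hz
    exact expNegInvGlue.zero_of_nonpos (by nlinarith)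
  · exact (expNegInvGlue.pos_of_pos (by simp)).ne'

theorem contDiff_stdMollifier (n : ℕ) : ContDiff ℝ 1 (stdMollifier n) := by
  rw [funext (stdMollifier_eq_expNegInvGlue n)]
  exact contDiff_const.mul (contDiff_expNegInvGlue_one_sub_norm_sq n)

theorem stdMollifier_nonneg (n : ℕ) (z : EuclideanSpace ℝ (Fin n)) : 0 ≤ stdMollifier n z := by
  rw [stdMollifier_eq_expNegInvGlue]
  exact mul_nonneg (inv_nonneg.2 (integral_expNegInvGlue_one_sub_norm_sq_pos n).le)
    (expNegInvGlue.nonneg _)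

theorem stdMollifier_eq_zero (n : ℕ) (z : EuclideanSpace ℝ (Fin n)) (hz : 1 ≤ ‖z‖) :
    stdMollifier n z = 0 := by
  simp [stdMollifier, hz.not_gt]

theorem stdMollifier_neg (n : ℕ) (z : EuclideanSpace ℝ (Fin n)) :
    stdMollifier n (-z) = stdMollifier n z := by
  simp [stdMollifier]

theorem integral_stdMollifier (n : ℕ) : ∫ z, stdMollifier n z = 1 := by
  simp_rw [stdMollifier_eq_expNegInvGlue]
  rw [integral_const_mul, inv_mul_cancel₀ (integral_expNegInvGlue_one_sub_norm_sq_pos n).ne']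

theorem norm_adjoint_comp_self_sub_id_le {E : Type*} [NormedAddCommGroup E]
    [InnerProductSpace ℝ E] [CompleteSpace E] {A L : E →L[ℝ] E} {Q P δ : ℝ} (hδ : 0 ≤ δ)
    (hδ1 : δ ≤ 1) (hL : ‖L‖ ≤ 2)
    (hLL : ‖(ContinuousLinearMap.adjoint L).comp L - ContinuousLinearMap.id ℝ E‖ ≤ Q * δ)
    (hA : ‖A - L‖ ≤ P * δ) :
    ‖(ContinuousLinearMap.adjoint A).comp A - ContinuousLinearMap.id ℝ E‖ ≤
      (Q + 4 * P + P ^ 2) * δ := by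
  set B := A - L with hB
  have h : (ContinuousLinearMap.adjoint A).comp A - ContinuousLinearMap.id ℝ E =
      ((ContinuousLinearMap.adjoint L).comp L - ContinuousLinearMap.id ℝ E) +
        (ContinuousLinearMap.adjoint L).comp B + (ContinuousLinearMap.adjoint B).comp L +
        (ContinuousLinearMap.adjoint B).comp B := by
    rw [show A = L + B by rw [hB]; abel, map_add]
    simp only [ContinuousLinearMap.add_comp, ContinuousLinearMap.comp_add]
    abel
  have hB0 := norm_nonneg B
  have b1 : ‖(ContinuousLinearMap.adjoint L).comp B‖ ≤ 2 * (P * δ) := by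
    refine (ContinuousLinearMap.opNorm_comp_le _ _).trans ?_
    rw [LinearIsometryEquiv.norm_map]
    gcongr
  have b2 : ‖(ContinuousLinearMap.adjoint B).comp L‖ ≤ (P * δ) * 2 := by
    refine (ContinuousLinearMap.opNorm_comp_le _ _).trans ?_
    rw [LinearIsometryEquiv.norm_map]
    exact mul_le_mul hA hL (norm_nonneg _) (hB0.trans hA)
  have b3 : ‖(ContinuousLinearMap.adjoint B).comp B‖ ≤ (P * δ) * (P * δ) := by
    refine (ContinuousLinearMap.opNorm_comp_le _ _).trans ?_
    rw [LinearIsometryEquiv.norm_map]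
    exact mul_le_mul hA hA hB0 (hB0.trans hA)
  rw [h]
  have t1 := norm_add_le (((ContinuousLinearMap.adjoint L).comp L - ContinuousLinearMap.id ℝ E) +
        (ContinuousLinearMap.adjoint L).comp B + (ContinuousLinearMap.adjoint B).comp L)
        ((ContinuousLinearMap.adjoint B).comp B)
  have t2 := norm_add₃_le (a := (ContinuousLinearMap.adjoint L).comp L - ContinuousLinearMap.id ℝ E)
    (b := (ContinuousLinearMap.adjoint L).comp B) (c := (ContinuousLinearMap.adjoint B).comp L)
  have t3 : (P * δ) * (P * δ) ≤ P ^ 2 * δ := by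
    nlinarith [mul_nonneg (sq_nonneg P) (mul_nonneg hδ (sub_nonneg.2 hδ1))]
  linarith

theorem exists_hasFDerivAt_rescaled_radius {E : Type*} [NormedAddCommGroup E]
    [InnerProductSpace ℝ E] {ρ : ℝ → ℝ} {b r : ℝ} (hr : 0 < r)
    (hρ : ContDiffOn ℝ 1 ρ (Set.Ici 1)) (hb : ∀ ℓ ≥ (1 : ℝ), |derivWithin ρ (Set.Ici 1) ℓ| ≤ b)
    {x : E} (hx : r < ‖x‖) :
    ∃ σ' : E →L[ℝ] ℝ, HasFDerivAt (fun w => ρ (‖w‖ / r) * r) σ' x ∧ ‖σ'‖ ≤ b := by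
  have hℓ : 1 < ‖x‖ / r := (one_lt_div hr).2 hx
  have hρd : HasDerivAt ρ (derivWithin ρ (Set.Ici 1) (‖x‖ / r)) (‖x‖ / r) :=
    ((hρ.differentiableOn one_ne_zero) _ hℓ.le).hasDerivWithinAt.hasDerivAt (Ici_mem_nhds hℓ)
  have hx0 : x ≠ 0 := norm_pos_iff.1 (hr.trans hx)
  have hnorm : HasFDerivAt (fun w : E => ‖w‖) (fderiv ℝ (fun w : E => ‖w‖) x) x :=
    ((contDiffAt_norm ℝ hx0 (n := 1)).differentiableAt one_ne_zero).hasFDerivAt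
  have hN : ‖fderiv ℝ (fun w : E => ‖w‖) x‖ ≤ 1 := by
    simpa using norm_fderiv_le_of_lipschitz ℝ (lipschitzWith_one_norm (E := E)) (x₀ := x)
  have hdiv : HasFDerivAt (fun w : E => ‖w‖ / r) (r⁻¹ • fderiv ℝ (fun w : E => ‖w‖) x) x := by
    simpa only [div_eq_mul_inv] using hnorm.mul_const r⁻¹
  refine ⟨_, (hρd.comp_hasFDerivAt x hdiv).mul_const r, ?_⟩
  rw [smul_smul, smul_smul, norm_smul]
  have h1 : ‖r * derivWithin ρ (Set.Ici 1) (‖x‖ / r) * r⁻¹‖ ≤ b := by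
    rw [show r * derivWithin ρ (Set.Ici 1) (‖x‖ / r) * r⁻¹ =
      derivWithin ρ (Set.Ici 1) (‖x‖ / r) by field_simp]
    exact hb _ hℓ.le
  exact (mul_le_mul h1 hN (norm_nonneg _) ((norm_nonneg _).trans h1)).trans (mul_one b).le

/-- **Bilipschitz estimate for mollification with varying scale on an
annulus.**  There exists `δ̄ = δ̄(n) < 1` such that for every `b > 0` there
exists `c = c(n,b)` such that for all `0 < δ < δ̄` and `r > 0`: if
`φ : D → C` is a smooth diffeomorphism with
`A(0,.5(1-δ)r,(10.5+.5δ)r) ⊆ D`, `B(φ(x),r/4) ⊆ C` for `x ∈ A(0,r,10r)`, and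
`φ` locally `(1+δ)`-bilipschitz on `A(0,.5(1-δ)r,(10.5+.5δ)r)`, and if
`ρ : [1,∞) → (0,1/4]` is `C¹` with `|ρ'| ≤ b` and `ρ_r(ℓ) := ρ(ℓ/r) r`, then
`‖(φ_{ρ_r})^*δ - δ‖_{C⁰(A(0,r,10r))} ≤ c δ`, i.e. for every `x ∈ A(0,r,10r)`,
`|(d_xφ_{ρ_r})ᵀ(d_xφ_{ρ_r}) - I| ≤ c δ`. -/
theorem mollified_annulus_pullback_estimate (n : ℕ) :
    ∃ δbar : ℝ, 0 < δbar ∧ δbar < 1 ∧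
    ∀ b : ℝ, 0 < b → ∃ c : ℝ, 0 < c ∧
      ∀ δ r : ℝ, 0 < δ → δ < δbar → 0 < r →
      ∀ D C : Set (EuclideanSpace ℝ (Fin n)), IsOpen D → IsOpen C →
      ∀ φ ψ : EuclideanSpace ℝ (Fin n) → EuclideanSpace ℝ (Fin n),
        ContDiffOn ℝ (⊤ : ℕ∞) φ D → φ '' D = C → ContDiffOn ℝ (⊤ : ℕ∞) ψ C →
        (∀ x ∈ D, ψ (φ x) = x) → (∀ y ∈ C, φ (ψ y) = y) →
        annulus n (0.5 * (1 - δ) * r) ((10.5 + 0.5 * δ) * r) ⊆ D →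
        (∀ x ∈ annulus n r (10 * r), ball (φ x) (r / 4) ⊆ C) →
        (∀ x ∈ annulus n (0.5 * (1 - δ) * r) ((10.5 + 0.5 * δ) * r),
          ∀ v : EuclideanSpace ℝ (Fin n), ‖v‖ = 1 →
            (1 + δ)⁻¹ ≤ ‖fderiv ℝ φ x v‖ ∧ ‖fderiv ℝ φ x v‖ ≤ 1 + δ) →
      ∀ ρ : ℝ → ℝ,
        ContDiffOn ℝ 1 ρ (Set.Ici 1) →
        (∀ ℓ ≥ (1 : ℝ), 0 < ρ ℓ ∧ ρ ℓ ≤ 1 / 4) →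
        (∀ ℓ ≥ (1 : ℝ), |derivWithin ρ (Set.Ici 1) ℓ| ≤ b) →
      ∀ x ∈ annulus n r (10 * r),
        ‖(ContinuousLinearMap.adjoint
            (fderiv ℝ (fun w => ∫ z : EuclideanSpace ℝ (Fin n),
              stdMollifier n z • φ (w - (ρ (‖w‖ / r) * r) • z)) x)).comp
            (fderiv ℝ (fun w => ∫ z : EuclideanSpace ℝ (Fin n),
              stdMollifier n z • φ (w - (ρ (‖w‖ / r) * r) • z)) x) -
          ContinuousLinearMap.id ℝ (EuclideanSpace ℝ (Fin n))‖ ≤ c * δ := by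
  have hn0 : (0 : ℝ) ≤ n := n.cast_nonneg
  obtain ⟨K, hK0, hK⟩ := exists_hasFDerivAt_mollification
    (volume : Measure (EuclideanSpace ℝ (Fin n))) (contDiff_stdMollifier n)
    (stdMollifier_nonneg n) (stdMollifier_eq_zero n) (stdMollifier_neg n) (integral_stdMollifier n)
  refine ⟨1 / (72 * ((n : ℝ) + 1) ^ 2), by positivity, ?_, ?_⟩
  · rw [div_lt_one (by positivity)]
    nlinarith
  intro b hb
  set N : ℝ := 36 * n + 72 * (n : ℝ) ^ 2 + 4 with hN
  set P : ℝ := K * N * (1 + b) with hP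
  refine ⟨36 * (n : ℝ) ^ 2 + 4 * P + P ^ 2 + 1, by positivity, ?_⟩
  intro δ r hδ hδbar hr D C hD hC φ ψ hφ hφD hψ hψφ hφψ hAD hBC hbil ρ hρ hρ4 hρb x hx
  rw [lt_div_iff₀ (by positivity), mul_comm] at hδbar
  have hδ1 : δ < 1 / 72 := by
    nlinarith [mul_nonneg hn0 hδ.le, mul_nonneg (mul_nonneg hn0 hn0) hδ.le]
  have hball : closedBall x (3 / 2 * (r / 4)) ⊆
      annulus n (0.5 * (1 - δ) * r) ((10.5 + 0.5 * δ) * r) := by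
    intro y hy
    rw [mem_closedBall, dist_eq_norm] at hy
    have h1 := norm_sub_norm_le x y
    have h2 := norm_sub_norm_le y x
    rw [norm_sub_rev] at h1
    have := mul_pos hδ hr
    constructor <;> nlinarith [hx.1, hx.2]
  have hxD : x ∈ D := hAD (hball (mem_closedBall_self (by positivity)))
  have hdiff : ∀ y ∈ closedBall x (3 / 2 * (r / 4)), DifferentiableAt ℝ φ y := fun y hy =>
    (hφ.differentiableOn (by simp) _ (hAD (hball hy))).differentiableAt
      (hD.mem_nhds (hAD (hball hy)))
  have hbil' : ∀ y ∈ closedBall x (3 / 2 * (r / 4)), ∀ v,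
      ‖fderiv ℝ φ y v‖ ≤ (1 + δ) * ‖v‖ ∧ ‖v‖ ≤ (1 + δ) * ‖fderiv ℝ φ y v‖ := by
    intro y hy v
    rcases eq_or_ne v 0 with rfl | hv
    · simp
    have hv0 : 0 < ‖v‖ := norm_pos_iff.2 hv
    have h := hbil y (hball hy) (‖v‖⁻¹ • v) (norm_smul_inv_norm hv)
    rw [map_smul, norm_smul, norm_inv, norm_norm, inv_mul_eq_div, le_div_iff₀ hv0,
      div_le_iff₀ hv0, inv_mul_le_iff₀ (by positivity)] at h
    exact h.symm
  have hψlip : ∀ p ∈ ball (φ x) (r / 4), ∀ q ∈ ball (φ x) (r / 4),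
      ‖ψ p - ψ q‖ ≤ (1 + δ) * ‖p - q‖ := fun p hp q hq =>
    rightInverse_norm_sub_le (K' := 3 / 2) (by positivity) (by linarith) (by positivity)
      (fun y hy => (hψ.differentiableOn (by simp) _ (hBC x hx hy)).differentiableAt
        (hC.mem_nhds (hBC x hx hy)))
      (fun y hy => hφψ y (hBC x hx hy)) (hψφ x hxD) hdiff
      (fun y hy v => (hbil' y hy v).2) hp hq
  have hℓ : 1 < ‖x‖ / r := (one_lt_div hr).2 hx.1
  obtain ⟨hρ0, hρ1⟩ := hρ4 _ hℓ.le
  set σ : ℝ := ρ (‖x‖ / r) * r with hσ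
  have hσ0 : 0 < σ := mul_pos hρ0 hr
  have hσr : σ ≤ r / 4 := by nlinarith
  have hmem : ∀ v, ‖v‖ ≤ σ → x + v ∈ closedBall x (3 / 2 * (r / 4)) := fun v hv => by
    rw [mem_closedBall, dist_eq_norm, add_sub_cancel_left]
    linarith
  have hup : ∀ v w, ‖v‖ < σ → ‖w‖ < σ → ‖φ (x + v) - φ (x + w)‖ ≤ (1 + δ) * ‖v - w‖ := by
    intro v w hv hw
    have := (convex_closedBall x (3 / 2 * (r / 4))).norm_image_sub_le_of_norm_fderiv_le (𝕜 := ℝ)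
      hdiff (fun y hy => ContinuousLinearMap.opNorm_le_bound _ (by positivity)
        fun v => (hbil' y hy v).1) (hmem w hw.le) (hmem v hv.le)
    simpa using this
  have himage : ∀ v, ‖v‖ ≤ (1 - δ) * σ → φ (x + v) ∈ ball (φ x) (r / 4) := by
    intro v hv
    have h := hup v 0 (by nlinarith) (by simpa using hσ0)
    rw [add_zero, sub_zero] at h
    rw [mem_ball, dist_eq_norm]
    have h2 : (1 + δ) * ‖v‖ ≤ (1 + δ) * ((1 - δ) * σ) := by gcongr
    nlinarith [mul_pos (mul_pos hδ hδ) hσ0]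
  have hlow : ∀ v w, ‖v‖ ≤ (1 - δ) * σ → ‖w‖ ≤ (1 - δ) * σ →
      (1 - δ) * ‖v - w‖ ≤ ‖φ (x + v) - φ (x + w)‖ := by
    intro v w hv hw
    have h := hψlip _ (himage v hv) _ (himage w hw)
    rw [hψφ _ (hAD (hball (hmem v (by nlinarith)))), hψφ _ (hAD (hball (hmem w (by nlinarith)))),
      add_sub_add_left_eq_sub] at h
    have h2 : (1 - δ) * ‖v - w‖ ≤ (1 - δ) * ((1 + δ) * ‖φ (x + v) - φ (x + w)‖) :=
      mul_le_mul_of_nonneg_left h (by linarith)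
    nlinarith [mul_nonneg (mul_nonneg hδ.le hδ.le) (norm_nonneg (φ (x + v) - φ (x + w)))]
  obtain ⟨L, hL2, hLL, hLφ⟩ := exists_linear_approx_of_near_isometry n
    (g := fun v => φ (x + v) - φ x) hδ hδbar hσ0 (by simp)
    (fun v w hv hw => by simpa using hup v w hv hw)
    (fun v w hv hw => by simpa using hlow v w hv hw)
  obtain ⟨σ', hσ', hσb⟩ := exists_hasFDerivAt_rescaled_radius hr hρ hρb hx.1
  obtain ⟨A, hA, hAL⟩ := hK φ (fun w => ρ (‖w‖ / r) * r) σ' L x (3 / 2 * (r / 4)) (N * δ)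
    (fun y hy => (hdiff y hy).continuousAt.continuousWithinAt) hσ' hσ0
    (show σ < _ by linarith) (fun y hy => by
      have := hLφ (y - x) (by rwa [mem_ball, dist_eq_norm] at hy)
      simpa using this)
  rw [hA.fderiv]
  have hAP : ‖A - L‖ ≤ P * δ := by
    refine hAL.trans ?_
    calc K * (N * δ) * (1 + ‖σ'‖) ≤ K * (N * δ) * (1 + b) := by gcongr
      _ = P * δ := by rw [hP]; ring
  have := norm_adjoint_comp_self_sub_id_le hδ.le (by linarith) hL2 hLL hAP
  linarith
end
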